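/- Let X and Y be nonempty finite subsets of C. If X match-dominates Y according to ≻, then u(X) > u(Y) for every utility function u consistent with ≻. -/

import Mathlib

/-- `u : C → ℝ` is consistent with the preference order ≻ on `C`
(we model ≻ by a linear order, where larger means more preferred):
`u a > u b ↔ a ≻ b`. -/
def Consistent {C : Type*} [LinearOrder C] (u : C → ℝ) : Prop :=
  ∀ a b : C, u a > u b ↔ b < a

/-- The average utility `u(X)` of a finite set `X` (expected utility of a
uniformly random element of `X`). -/
noncomputable def avg {C : Type*} (u : C → ℝ) (X : Finset C) : ℝ :=
  (∑ c ∈ X, u c) / (X.card : ℝ)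

/-- `C^(j)`: the set of the `j` most-preferred candidates. -/
def topSet (C : Type*) [LinearOrder C] [Fintype C] (j : ℕ) : Finset C :=
  Finset.univ.filter fun c => (Finset.univ.filter fun d => c ≤ d).card ≤ j

/-- `X` stochastically dominates `Y` under uniform tie-breaking:
`|X ∩ C^(j)|/|X| ≥ |Y ∩ C^(j)|/|Y|` for every `j = 1, …, |C|`, strict for some `j`. -/
def StochDom {C : Type*} [LinearOrder C] [Fintype C] (X Y : Finset C) : Prop :=
  (∀ j ∈ Finset.Icc 1 (Fintype.card C),
      ((Y ∩ topSet C j).card : ℝ) / (Y.card : ℝ) ≤ ((X ∩ topSet C j).card : ℝ) / (X.card : ℝ)) ∧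
  (∃ j ∈ Finset.Icc 1 (Fintype.card C),
      ((Y ∩ topSet C j).card : ℝ) / (Y.card : ℝ) < ((X ∩ topSet C j).card : ℝ) / (X.card : ℝ))

/-- Core of match-domination, stated for lists `xs` (of length `k`) and `ys`
(of length `K ≥ k`) enumerated in increasing preference, where `le y x` means
`x ⪰ y` and `lt y x` means `x ≻ y`.  With 0-based indices, `r j = ⌈jK/k⌉ = (jK + k - 1)/k`
and the block `Y_j` consists of positions `i` with `r j ≤ i < r (j+1)`. -/
def MatchDomCore {C : Type*} (le lt : C → C → Prop) (xs ys : List C) : Prop :=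
  xs.length ≤ ys.length ∧
  (∀ (j : Fin xs.length) (i : Fin ys.length),
      (j.val * ys.length + xs.length - 1) / xs.length ≤ i.val →
      i.val < ((j.val + 1) * ys.length + xs.length - 1) / xs.length →
      le (ys.get i) (xs.get j)) ∧
  ((∃ (j : Fin xs.length) (i : Fin ys.length),
      (j.val * ys.length + xs.length - 1) / xs.length ≤ i.val ∧
      i.val < ((j.val + 1) * ys.length + xs.length - 1) / xs.length ∧
      lt (ys.get i) (xs.get j)) ∨ ¬ (xs.length ∣ ys.length))

/-- `X` match-dominates `Y` according to the preference order.  If `|X| ≤ |Y|`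
this is the ascending-enumeration condition; if `|X| > |Y|` it requires that `Y`
match-dominates `X` with respect to the reversed order. -/
def MatchDom {C : Type*} [LinearOrder C] (X Y : Finset C) : Prop :=
  if X.card ≤ Y.card then
    MatchDomCore (· ≤ ·) (· < ·) (X.sort (· ≤ ·)) (Y.sort (· ≤ ·))
  else
    MatchDomCore (· ≥ ·) (· > ·) ((Y.sort (· ≤ ·)).reverse) ((X.sort (· ≤ ·)).reverse)


theorem add_sub_one_div_le_iff_le_mul {n k i : ℕ} (hk : 0 < k) :
    (n + k - 1) / k ≤ i ↔ n ≤ i * k := by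
  rw [← Nat.lt_succ_iff, Nat.div_lt_iff_lt_mul hk, Nat.succ_mul]
  omega

theorem sum_range_mul_div (f : ℕ → ℝ) {m : ℕ} (hm : 0 < m) (n : ℕ) :
    ∑ t ∈ Finset.range (n * m), f (t / m) = m * ∑ i ∈ Finset.range n, f i := by
  induction n with
  | zero => simp
  | succ n ih =>
    rw [Nat.succ_mul, Finset.sum_range_add, ih, Finset.sum_range_succ, mul_add]
    congr 1
    rw [Finset.sum_congr rfl (g := fun _ => f n)]
    · simp
    · intro t ht
      rw [mul_comm, Nat.mul_add_div hm, Nat.div_eq_of_lt (Finset.mem_range.1 ht), add_zero]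

/-- Real sequences with block-wise comparisons, where position `i` of the longer sequence `b`
belongs to block `j` when `j * K ≤ i * k < (j + 1) * K`. -/
theorem mul_sum_lt_mul_sum_of_blocks {k K : ℕ} (hk : 0 < k) (hkK : k ≤ K) {a b : ℕ → ℝ}
    (ha : ∀ i j, i < j → j < k → a i < a j) (hb : ∀ i j, i < j → j < K → b i < b j)
    (hle : ∀ j i, j < k → i < K → j * K ≤ i * k → i * k < (j + 1) * K → b i ≤ a j)
    (hlt : (∃ j i, j < k ∧ i < K ∧ j * K ≤ i * k ∧ i * k < (j + 1) * K ∧ b i < a j) ∨ ¬ k ∣ K) :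
    (k : ℝ) * ∑ i ∈ Finset.range K, b i < K * ∑ j ∈ Finset.range k, a j := by
  have hK : 0 < K := hk.trans_le hkK
  have below : ∀ j i, j < k → i * k < (j + 1) * K → b i ≤ a j := by
    intro j i hj hi
    have hpos : 0 < (j + 1) * K := by positivity
    set l := ((j + 1) * K - 1) / k with hl
    have h1 : l * k ≤ (j + 1) * K - 1 := Nat.div_mul_le_self _ _
    have h2 : (j + 1) * K - 1 < (l + 1) * k := (Nat.div_lt_iff_lt_mul hk).1 (Nat.lt_succ_self _)
    have h3 : i ≤ l := (Nat.le_div_iff_mul_le hk).2 (by omega)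
    have h4 : l < K := by
      have : (j + 1) * K ≤ k * K := Nat.mul_le_mul_right _ hj
      refine Nat.lt_of_mul_lt_mul_right (a := k) ?_
      rw [mul_comm K k]
      omega
    have h5 : b l ≤ a j := by
      refine hle j l hj h4 ?_ (by omega)
      have h5 : (j + 1) * K = j * K + K := Nat.succ_mul j K
      have h6 : (l + 1) * k = l * k + k := Nat.succ_mul l k
      omega
    rcases h3.lt_or_eq with h | h
    · exact (hb i l h h4).le.trans h5
    · rwa [h]
  rw [← sum_range_mul_div b hk, ← sum_range_mul_div a hK, mul_comm K k]
  refine Finset.sum_lt_sum (fun t ht => ?_) ?_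
  · refine below _ _ (Nat.div_lt_of_lt_mul (by rw [mul_comm]; exact Finset.mem_range.1 ht)) ?_
    exact (Nat.div_mul_le_self t k).trans_lt ((Nat.div_lt_iff_lt_mul hK).1 (Nat.lt_succ_self _))
  · rcases hlt with ⟨j, i, hj, hi, h1, h2, h3⟩ | hdvd
    · refine ⟨i * k, Finset.mem_range.2 ?_, ?_⟩
      · rw [mul_comm k K]
        exact Nat.mul_lt_mul_of_pos_right hi hk
      · rwa [Nat.mul_div_cancel _ hk, Nat.div_eq_of_lt_le h1 h2]
    · have hk2 : 1 < k := by
        by_contra h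
        exact hdvd (by rw [show k = 1 by omega]; exact one_dvd K)
      refine ⟨K, Finset.mem_range.2 (by nlinarith), ?_⟩
      rw [Nat.div_self hK]
      refine (below 0 (K / k) hk ?_).trans_lt (ha 0 1 Nat.zero_lt_one hk2)
      rw [zero_add, one_mul]
      exact lt_of_le_of_ne (Nat.div_mul_le_self K k) fun h => hdvd ⟨K / k, by rw [mul_comm, h]⟩

theorem MatchDomCore.mul_sum_lt_mul_sum {C : Type*} {le lt : C → C → Prop} {xs ys : List C}
    (h : MatchDomCore le lt xs ys) (hxs : 0 < xs.length) {v : C → ℝ}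
    (hle : ∀ y x, le y x → v y ≤ v x) (hlt : ∀ y x, lt y x → v y < v x)
    (hx : xs.Pairwise (fun c d => v c < v d)) (hy : ys.Pairwise (fun c d => v c < v d)) :
    (xs.length : ℝ) * (ys.map v).sum < ys.length * (xs.map v).sum := by
  have sum_eq (l : List C) :
      (l.map v).sum = ∑ i ∈ Finset.range l.length, (l.map v).getD i 0 := by
    rw [Finset.sum_range, ← Fin.sum_univ_getElem]
    refine Fintype.sum_equiv (finCongr (by simp)) _ _ fun i => ?_
    rw [List.getD_eq_getElem _ _ (by simpa using i.2)]
    rfl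
  have getD_eq {l : List C} {i : ℕ} (hi : i < l.length) : (l.map v).getD i 0 = v l[i] := by
    rw [List.getD_eq_getElem _ _ (by simpa using hi), List.getElem_map]
  have mono {l : List C} (hl : l.Pairwise (fun c d => v c < v d)) :
      ∀ i j, i < j → j < l.length → (l.map v).getD i 0 < (l.map v).getD j 0 := by
    intro i j hij hj
    rw [getD_eq hj, getD_eq (hij.trans hj)]
    exact List.pairwise_iff_getElem.1 hl i j _ _ hij
  obtain ⟨hlen, hI, hII⟩ := h
  simp only [← not_le, add_sub_one_div_le_iff_le_mul hxs] at hI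
  simp only [← not_le (α := ℕ), add_sub_one_div_le_iff_le_mul hxs] at hII
  rw [sum_eq xs, sum_eq ys]
  refine mul_sum_lt_mul_sum_of_blocks hxs hlen (mono hx) (mono hy) ?_ (hII.imp_left ?_)
  · intro j i hj hi h1 h2
    rw [getD_eq hj, getD_eq hi]
    exact hle _ _ (hI ⟨j, hj⟩ ⟨i, hi⟩ h1 h2.not_ge)
  · rintro ⟨j, i, h1, h2, h3⟩
    refine ⟨j, i, j.2, i.2, h1, not_le.1 h2, ?_⟩
    rw [getD_eq j.2, getD_eq i.2]
    exact hlt _ _ h3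

theorem sum_map_sort {C : Type*} [LinearOrder C] (v : C → ℝ) (X : Finset C) :
    ((X.sort (· ≤ ·)).map v).sum = ∑ c ∈ X, v c := by
  rw [← List.sum_toFinset v (X.sort_nodup _), Finset.sort_toFinset]

/-- if `X` match-dominates `Y` according to `≻`, then `u(X) > u(Y)` for
every utility function `u` consistent with `≻`. -/
theorem stmt_2 {C : Type*} [LinearOrder C] [Fintype C] [Nonempty C]
    (X Y : Finset C) (hX : X.Nonempty) (hY : Y.Nonempty)
    (h : MatchDom X Y) :
    ∀ u : C → ℝ, Consistent u → avg u Y < avg u X := by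
  intro u hu
  have hlt : StrictMono u := fun a b hab => (hu b a).2 hab
  have hXc : (0 : ℝ) < X.card := by exact_mod_cast hX.card_pos
  have hYc : (0 : ℝ) < Y.card := by exact_mod_cast hY.card_pos
  have sorted (Z : Finset C) : (Z.sort (· ≤ ·)).Pairwise (fun c d => u c < u d) :=
    (Z.sortedLT_sort.pairwise).imp fun hcd => hlt hcd
  rw [avg, avg, div_lt_div_iff₀ hYc hXc]
  unfold MatchDom at h
  split_ifs at h
  · have := h.mul_sum_lt_mul_sum (v := u) (by simpa using hX.card_pos)
      (fun _ _ hyx => hlt.monotone hyx) (fun _ _ hyx => hlt hyx) (sorted X) (sorted Y)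
    simp only [sum_map_sort, Finset.length_sort] at this
    linarith
  · have sorted_reverse (Z : Finset C) :
        (Z.sort (· ≤ ·)).reverse.Pairwise (fun c d => -u c < -u d) :=
      List.pairwise_reverse.2 ((sorted Z).imp fun hcd => neg_lt_neg hcd)
    have := h.mul_sum_lt_mul_sum (v := fun c => -u c) (by simpa using hY.card_pos)
      (fun _ _ hyx => neg_le_neg (hlt.monotone hyx)) (fun _ _ hyx => neg_lt_neg (hlt hyx))
      (sorted_reverse Y) (sorted_reverse X)
    simp only [List.map_reverse, List.sum_reverse, sum_map_sort, List.length_reverse,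
      Finset.length_sort, Finset.sum_neg_distrib] at this
    linarith
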